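/- arXiv:1505.01539 — 10 statements merged into one kernel-verified Lean document; each statement's English description precedes it below -/
import Mathlib

section
/- Hammersley–Clifford theorem (hard direction): Let P be a positive joint probability distribution on A = ∏_{i∈V} A_i that is a Markov random field with respect to an undirected simple graph G on the finite vertex set V. Then P is a Gibbs distribution with respect to G; that is, there exist functions φ_C : A_C → ℝ, one for each maximal clique C of G, such that P(x) is proportional to exp(Σ_{C∈𝒞} φ_C(x_C)) for all x, where 𝒞 is the set of maximal cliques of G. -/
/-- `C` is a maximal clique of the simple graph `G`. -/
def IsMaxClique {V : Type*} (G : SimpleGraph V) (C : Finset V) : Prop :=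
  G.IsClique (C : Set V) ∧ ∀ D : Finset V, G.IsClique (D : Set V) → C ⊆ D → C = D

/-- A real-valued function of a joint configuration depends only on the coordinates in `C`. -/
def LocalOn {V : Type*} {A : V → Type*} (C : Finset V) (φ : (∀ i, A i) → ℝ) : Prop :=
  ∀ x y : ∀ i, A i, (∀ j ∈ C, x j = y j) → φ x = φ y

/-- The Möbius transform of a set function `f` on the lattice of finite sets. -/
noncomputable def mobiusTransform {V : Type*} [DecidableEq V] (f : Finset V → ℝ)
    (B : Finset V) : ℝ :=
  ∑ S ∈ B.powerset, (-1) ^ (B.card + S.card) * f S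

theorem mobiusTransform_insert {V : Type*} [DecidableEq V] (f : Finset V → ℝ)
    {a : V} {B : Finset V} (ha : a ∉ B) :
    mobiusTransform f (insert a B) =
      mobiusTransform (fun S => f (insert a S)) B - mobiusTransform f B := by
  unfold mobiusTransform
  rw [Finset.sum_powerset_insert ha, add_comm, sub_eq_add_neg, ← Finset.sum_neg_distrib]
  congr 1 <;> refine Finset.sum_congr rfl fun S hS => ?_
  · have haS : a ∉ S := fun h => ha (Finset.mem_powerset.1 hS h)
    rw [Finset.card_insert_of_notMem ha, Finset.card_insert_of_notMem haS]
    ring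
  · rw [Finset.card_insert_of_notMem ha]
    ring

/-- Möbius inversion on the lattice of finite sets. -/
theorem sum_powerset_mobiusTransform {V : Type*} [DecidableEq V] (f : Finset V → ℝ)
    (T : Finset V) : ∑ B ∈ T.powerset, mobiusTransform f B = f T := by
  induction T using Finset.induction_on generalizing f with
  | empty => simp [mobiusTransform]
  | insert a T ha ih =>
    have h : ∀ B ∈ T.powerset, mobiusTransform f (insert a B) =
        mobiusTransform (fun S => f (insert a S)) B - mobiusTransform f B := fun B hB =>
      mobiusTransform_insert f fun h => ha (Finset.mem_powerset.1 hB h)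
    rw [Finset.sum_powerset_insert ha, Finset.sum_congr rfl h, Finset.sum_sub_distrib, ih, ih]
    ring

/-- The Möbius transform vanishes on sets containing two distinct points whose mixed second
difference is always zero. -/
theorem mobiusTransform_eq_zero {V : Type*} [DecidableEq V] (f : Finset V → ℝ)
    {i j : V} (hij : i ≠ j)
    (hf : ∀ S : Finset V, i ∉ S → j ∉ S →
      f (insert i (insert j S)) + f S = f (insert i S) + f (insert j S))
    {B : Finset V} (hi : i ∈ B) (hj : j ∈ B) : mobiusTransform f B = 0 := by
  obtain ⟨T, hiT, hjT, rfl⟩ : ∃ T : Finset V, i ∉ T ∧ j ∉ T ∧ B = insert i (insert j T) :=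
    ⟨(B.erase i).erase j, by simp, by simp, by
      rw [Finset.insert_erase (Finset.mem_erase.2 ⟨hij.symm, hj⟩), Finset.insert_erase hi]⟩
  rw [mobiusTransform_insert f (by simp [hij, hiT]), mobiusTransform_insert _ hjT,
    mobiusTransform_insert _ hjT]
  simp only [mobiusTransform, ← Finset.sum_sub_distrib]
  refine Finset.sum_eq_zero fun S hS => ?_
  have h := hf S (fun h => hiT (Finset.mem_powerset.1 hS h))
    (fun h => hjT (Finset.mem_powerset.1 hS h))
  linear_combination (-1) ^ (T.card + S.card) * h

/-- Every clique of a finite graph is contained in a maximal clique. -/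
theorem exists_isMaxClique_superset {V : Type*} [Finite V] {G : SimpleGraph V} {B : Finset V}
    (hB : G.IsClique (B : Set V)) : ∃ C : Finset V, IsMaxClique G C ∧ B ⊆ C := by
  obtain ⟨C, hBC, hC⟩ :=
    Finite.exists_le_maximal (p := fun D : Finset V => G.IsClique (D : Set V)) hB
  exact ⟨C, ⟨hC.prop, fun D hD hCD => hC.eq_of_le hD hCD⟩, hBC⟩

/-- For a positive Markov random field, the log-probabilities of configurations that agree with
`x` on a set and with a reference configuration `o` off it have vanishing mixed differences at
non-adjacent sites. -/
theorem log_piecewise_mixed_difference {V : Type*} [DecidableEq V] (G : SimpleGraph V)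
    {A : V → Type*} [∀ i, Fintype (A i)] (P : (∀ i, A i) → ℝ) (hpos : ∀ x, 0 < P x)
    (hMRF : ∀ (i : V) (x y : ∀ j, A j), x i = y i →
      (∀ j ∈ G.neighborSet i, x j = y j) →
      P x / (∑ a : A i, P (Function.update x i a)) =
        P y / (∑ a : A i, P (Function.update y i a)))
    (x o : ∀ i, A i) {i j : V} (hij : i ≠ j) (hadj : ¬ G.Adj i j)
    (S : Finset V) :
    Real.log (P ((insert i (insert j S)).piecewise x o)) + Real.log (P (S.piecewise x o)) =
      Real.log (P ((insert i S).piecewise x o)) +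
        Real.log (P ((insert j S).piecewise x o)) := by
  have hne : ∀ k ∈ G.neighborSet i, k ≠ j := by
    rintro k hk rfl
    exact hadj hk
  have h₁ := hMRF i ((insert i (insert j S)).piecewise x o) ((insert i S).piecewise x o)
    (by simp) (fun k hk => by simp [Finset.piecewise, hne k hk])
  have h₂ := hMRF i ((insert j S).piecewise x o) (S.piecewise x o)
    (by simp [Finset.piecewise, hij]) (fun k hk => by simp [Finset.piecewise, hne k hk])
  simp only [Finset.piecewise_insert _ x o i, Function.update_idem] at h₁ ⊢
  have hsum : ∀ y : ∀ k, A k, 0 < ∑ a : A i, P (Function.update y i a) := fun y =>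
    Finset.sum_pos (fun _ _ => hpos _) ⟨y i, Finset.mem_univ _⟩
  rw [div_eq_div_iff (hsum _).ne' (hsum _).ne'] at h₁ h₂
  rw [← Real.log_mul (hpos _).ne' (hpos _).ne', ← Real.log_mul (hpos _).ne' (hpos _).ne']
  congr 1
  refine mul_right_cancel₀
    (mul_pos (hsum (S.piecewise x o)) (hsum ((insert j S).piecewise x o))).ne' ?_
  linear_combination
    P (S.piecewise x o) *
      (∑ a : A i, P (Function.update ((insert j S).piecewise x o) i a)) * h₁ -
    P (Function.update (S.piecewise x o) i (x i)) *
      (∑ a : A i, P (Function.update ((insert j S).piecewise x o) i a)) * h₂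

/-- Hammersley–Clifford theorem (hard direction): every positive joint distribution that is
a Markov random field with respect to `G` is a Gibbs distribution with respect to `G`,
i.e. proportional to the exponential of a sum of local potentials over the maximal cliques. -/
theorem hammersley_clifford_hard
    {V : Type*} [Fintype V] [DecidableEq V] (G : SimpleGraph V)
    {A : V → Type*} [∀ i, Fintype (A i)] [∀ i, Nonempty (A i)]
    (P : (∀ i, A i) → ℝ)
    (hpos : ∀ x, 0 < P x)
    (hsum : ∑ x, P x = 1)
    (hMRF : ∀ (i : V) (x y : ∀ j, A j), x i = y i →
      (∀ j ∈ G.neighborSet i, x j = y j) →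
      P x / (∑ a : A i, P (Function.update x i a)) =
        P y / (∑ a : A i, P (Function.update y i a))) :
    ∃ (φ : Finset V → ((∀ i, A i) → ℝ)) (Z : ℝ), 0 < Z ∧
      (∀ C : Finset V, ¬ IsMaxClique G C → φ C = 0) ∧
      (∀ C : Finset V, LocalOn C (φ C)) ∧
      (∀ x, P x = Z * Real.exp (∑ C : Finset V, φ C x)) := by
  classical
  let o : ∀ i, A i := fun i => Classical.arbitrary (A i)
  let ψ : Finset V → (∀ i, A i) → ℝ := fun B x =>
    mobiusTransform (fun S => Real.log (P (S.piecewise x o))) B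
  have hψ_local : ∀ B C : Finset V, B ⊆ C → LocalOn C (ψ B) := by
    intro B C hBC x y hxy
    refine Finset.sum_congr rfl fun S hS => ?_
    have h : S.piecewise x o = S.piecewise y o :=
      Finset.piecewise_congr _ (fun k hk => hxy k (hBC (Finset.mem_powerset.1 hS hk)))
        fun _ _ => rfl
    simp only [h]
  have hψ_zero : ∀ (B : Finset V) (x : ∀ i, A i), ¬ G.IsClique (B : Set V) → ψ B x = 0 := by
    intro B x hB
    simp only [SimpleGraph.IsClique, Set.Pairwise, not_forall] at hB
    obtain ⟨i, hi, j, hj, hij, hadj⟩ := hB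
    exact mobiusTransform_eq_zero _ hij
      (fun S _ _ => log_piecewise_mixed_difference G P hpos hMRF x o hij hadj S) hi hj
  have hM : ∀ B : Finset V, ∃ C : Finset V,
      G.IsClique (B : Set V) → IsMaxClique G C ∧ B ⊆ C := by
    intro B
    by_cases hB : G.IsClique (B : Set V)
    · obtain ⟨C, hC⟩ := exists_isMaxClique_superset hB
      exact ⟨C, fun _ => hC⟩
    · exact ⟨B, fun h => absurd h hB⟩
  choose M hM using hM
  refine ⟨fun C x => ∑ B : Finset V with M B = C, if G.IsClique (B : Set V) then ψ B x else 0,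
    1, one_pos, ?_, ?_, ?_⟩
  · intro C hC
    funext x
    refine Finset.sum_eq_zero fun B hB => if_neg fun hcl => hC ?_
    rw [← (Finset.mem_filter.1 hB).2]
    exact (hM B hcl).1
  · intro C x y hxy
    refine Finset.sum_congr rfl fun B hB => ?_
    split_ifs with hcl
    · refine hψ_local B C ?_ x y hxy
      rw [← (Finset.mem_filter.1 hB).2]
      exact (hM B hcl).2
    · rfl
  · intro x
    have hite : ∀ B : Finset V, (if G.IsClique (B : Set V) then ψ B x else 0) = ψ B x :=
      fun B => ite_eq_left_iff.2 fun hcl => (hψ_zero B x hcl).symm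
    have hlog : ∑ B : Finset V, ψ B x = Real.log (P x) := by
      simpa [ψ] using
        sum_powerset_mobiusTransform (fun S => Real.log (P (S.piecewise x o))) Finset.univ
    simp only [hite]
    rw [Finset.sum_fiberwise, hlog, Real.exp_log (hpos x), one_mul]
end

section
/- Hammersley–Clifford theorem (easy direction): Let P be a positive joint probability distribution on A = ∏_{i∈V} A_i that is a Gibbs distribution with respect to an undirected simple graph G, i.e., P(x) is proportional to exp(Σ_{C∈𝒞} φ_C(x_C)) for some functions φ_C : A_C → ℝ indexed by the maximal cliques 𝒞 of G. Then P is a Markov random field with respect to G: for every i and every x, the conditional probability P(X_i = x_i | X_{-i} = x_{-i}) = P(x)/Σ_{x'_i} P(x'_i, x_{-i}) depends on x_{-i} only through x_{𝒩(i)}. -/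
theorem LocalOn.update_add_eq_add_update {V : Type*} [DecidableEq V] {G : SimpleGraph V}
    {A : V → Type*} {C : Finset V} {φ : (∀ i, A i) → ℝ} (hφ : LocalOn C φ)
    (hC : G.IsClique (C : Set V)) {i : V} {x y : ∀ j, A j} (hi : x i = y i)
    (hxy : ∀ j ∈ G.neighborSet i, x j = y j) (a : A i) :
    φ x + φ (Function.update y i a) = φ y + φ (Function.update x i a) := by
  by_cases hiC : i ∈ C
  · have agree : ∀ j ∈ C, x j = y j := by
      intro j hj
      by_cases hji : j = i
      · subst hji
        exact hi
      · exact hxy j (hC hiC hj (Ne.symm hji))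
    rw [hφ x y agree, hφ (Function.update x i a) (Function.update y i a)]
    intro j hj
    by_cases hji : j = i
    · subst hji
      simp
    · simp [hji, agree j hj]
  · have update_eq (z : ∀ j, A j) : φ (Function.update z i a) = φ z := by
      refine hφ _ _ fun j hj => Function.update_of_ne ?_ _ _
      rintro rfl
      exact hiC hj
    rw [update_eq, update_eq, add_comm]

/-- Hammersley–Clifford theorem (easy direction): every positive joint distribution that is a
Gibbs distribution with respect to `G` (proportional to the exponential of a sum of local
potentials over the maximal cliques of `G`) is a Markov random field with respect to `G`:
the conditional of site `i` depends on the other coordinates only through the neighbors of `i`. -/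
theorem hammersley_clifford_easy
    {V : Type*} [Fintype V] [DecidableEq V] (G : SimpleGraph V)
    {A : V → Type*} [∀ i, Fintype (A i)] [∀ i, Nonempty (A i)]
    (P : (∀ i, A i) → ℝ)
    (hpos : ∀ x, 0 < P x)
    (hsum : ∑ x, P x = 1)
    (φ : Finset V → ((∀ i, A i) → ℝ)) (Z : ℝ) (hZ : 0 < Z)
    (hφmax : ∀ C : Finset V, ¬ IsMaxClique G C → φ C = 0)
    (hφlocal : ∀ C : Finset V, LocalOn C (φ C))
    (hGibbs : ∀ x, P x = Z * Real.exp (∑ C : Finset V, φ C x)) :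
    ∀ (i : V) (x y : ∀ j, A j), x i = y i →
      (∀ j ∈ G.neighborSet i, x j = y j) →
      P x / (∑ a : A i, P (Function.update x i a)) =
        P y / (∑ a : A i, P (Function.update y i a)) := by
  intro i x y hi hxy
  have sum_pos (z : ∀ j, A j) : 0 < ∑ a : A i, P (Function.update z i a) :=
    Finset.sum_pos (fun a _ => hpos _) Finset.univ_nonempty
  rw [div_eq_div_iff (sum_pos x).ne' (sum_pos y).ne', Finset.mul_sum, Finset.mul_sum]
  refine Finset.sum_congr rfl fun a _ => ?_
  simp only [hGibbs]
  rw [mul_mul_mul_comm, mul_mul_mul_comm Z (Real.exp (∑ C, φ C y)), ← Real.exp_add, ← Real.exp_add,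
    ← Finset.sum_add_distrib, ← Finset.sum_add_distrib]
  congr 2
  refine Finset.sum_congr rfl fun C _ => ?_
  by_cases hC : IsMaxClique G C
  · exact (hφlocal C).update_add_eq_add_update hC.1 hi hxy a
  · simp [hφmax C hC]
end

section
/- Let Ψ be an f-transformed potential of a graphical game with graph G, where each transform f_i admits a conditional inverse f_i^{-1} : ℝ × A_{𝒩(i)} → ℝ satisfying f_i^{-1}(f_i(v, x_{𝒩(i)}), x_{𝒩(i)}) = v for all v and x_{𝒩(i)}. Define the positive distribution P on A by P(x) = exp(Ψ(x)) / Σ_y exp(Ψ(y)). Then for every player i and every x, P(X_i = x_i | X_{-i} = x_{-i}) = 1 / Σ_{x'_i∈A_i} exp( f_i^{-1}( M′_i(x'_i, x_{𝒩(i)}) − M′_i(x_i, x_{𝒩(i)}), x_{𝒩(i)}) ); in particular this conditional depends on x_{-i} only through x_{𝒩(i)}, so P is a Markov random field with respect to G. -/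
/-- The conditional probability computed from normalized exponential weights does not depend on
the normalizing constant and only involves differences of exponents. -/
theorem exp_div_sum_exp_div {ι : Type*} [Fintype ι] (g : ι → ℝ) (c : ℝ) {Z : ℝ} (hZ : Z ≠ 0) :
    (Real.exp c / Z) / (∑ a, Real.exp (g a) / Z) = 1 / ∑ a, Real.exp (g a - c) := by
  simp_rw [Real.exp_sub, ← Finset.sum_div]
  rw [div_div_div_cancel_right₀ hZ, one_div_div]


/-- Let `Ψ` be an `f`-transformed potential of a graphical game with graph `G`, where each
transform `f i` admits a conditional inverse `finv i`.  Define `P x = exp (Ψ x) / ∑ y, exp (Ψ y)`.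
Then the conditional of `P` at player `i` equals
`1 / ∑ a', exp (finv i (M i (a', x_{-i}) - M i x) x)`, and in particular `P` is a Markov
random field with respect to `G`. -/
theorem transformed_potential_gives_MRF
    {V : Type*} [Fintype V] [DecidableEq V] (G : SimpleGraph V)
    {A : V → Type*} [∀ i, Fintype (A i)] [∀ i, Nonempty (A i)]
    (M : V → (∀ i, A i) → ℝ)
    (hMlocal : ∀ (i : V) (x y : ∀ j, A j), x i = y i →
      (∀ j, G.Adj i j → x j = y j) → M i x = M i y)
    (f : V → ℝ → (∀ i, A i) → ℝ)
    (hflocal : ∀ (i : V) (v : ℝ) (x y : ∀ j, A j),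
      (∀ j, G.Adj i j → x j = y j) → f i v x = f i v y)
    (finv : V → ℝ → (∀ i, A i) → ℝ)
    (hfinvlocal : ∀ (i : V) (v : ℝ) (x y : ∀ j, A j),
      (∀ j, G.Adj i j → x j = y j) → finv i v x = finv i v y)
    (hinv : ∀ (i : V) (v : ℝ) (x : ∀ j, A j), finv i (f i v x) x = v)
    (Ψ : (∀ i, A i) → ℝ)
    (hpot : ∀ (i : V) (x : ∀ j, A j) (a a' : A i),
      M i (Function.update x i a) - M i (Function.update x i a') =
        f i (Ψ (Function.update x i a) - Ψ (Function.update x i a')) x) :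
    (∀ (i : V) (x : ∀ j, A j),
      (Real.exp (Ψ x) / ∑ y, Real.exp (Ψ y)) /
          (∑ a : A i, Real.exp (Ψ (Function.update x i a)) / ∑ y, Real.exp (Ψ y)) =
        1 / ∑ a : A i, Real.exp (finv i (M i (Function.update x i a) - M i x) x)) ∧
    (∀ (i : V) (x y : ∀ j, A j), x i = y i →
      (∀ j ∈ G.neighborSet i, x j = y j) →
      (Real.exp (Ψ x) / ∑ z, Real.exp (Ψ z)) /
          (∑ a : A i, Real.exp (Ψ (Function.update x i a)) / ∑ z, Real.exp (Ψ z)) =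
        (Real.exp (Ψ y) / ∑ z, Real.exp (Ψ z)) /
          (∑ a : A i, Real.exp (Ψ (Function.update y i a)) / ∑ z, Real.exp (Ψ z))) := by
  have hZ : ∑ z, Real.exp (Ψ z) ≠ 0 :=
    (Finset.sum_pos (fun z _ => Real.exp_pos (Ψ z)) Finset.univ_nonempty).ne'
  have hcond : ∀ (i : V) (x : ∀ j, A j),
      (Real.exp (Ψ x) / ∑ y, Real.exp (Ψ y)) /
          (∑ a : A i, Real.exp (Ψ (Function.update x i a)) / ∑ y, Real.exp (Ψ y)) =
        1 / ∑ a : A i, Real.exp (finv i (M i (Function.update x i a) - M i x) x) := by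
    intro i x
    rw [exp_div_sum_exp_div (fun a => Ψ (Function.update x i a)) (Ψ x) hZ]
    congr! 3 with a
    have h := hpot i x a (x i)
    rw [Function.update_eq_self] at h
    rw [h, hinv]
  refine ⟨hcond, fun i x y hi hN => ?_⟩
  rw [hcond, hcond]
  have hupdate : ∀ a : A i,
      M i (Function.update x i a) = M i (Function.update y i a) := fun a =>
    hMlocal i _ _ (by simp) fun j hj => by
      rw [Function.update_of_ne hj.ne', Function.update_of_ne hj.ne', hN j hj]
  simp_rw [hupdate, hMlocal i x y hi hN, hfinvlocal i _ x y hN]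
end

section
/- Any w-weighted Gibbs-potential game with graph G and potential Ψ is w-scaled payoff-difference equivalent to a hyperedge-symmetric hypergraphical game whose hyperedges are the maximal cliques of G: there exist functions φ_C : A_C → ℝ, one for each maximal clique C of G, such that Ψ(x) = Σ_{C∈𝒞} φ_C(x_C) and, for every player i, all x_{-i}, and all x_i, x'_i ∈ A_i, M_i(x_i, x_{-i}) − M_i(x'_i, x_{-i}) = w_i · Σ_{C∈𝒞 : i∈C} ( φ_C((x_i, x_{C∖{i}})) − φ_C((x'_i, x_{C∖{i}})) ). -/
/-- `f` is a sum of functions, each depending only on the coordinates in one maximal clique. -/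
def IsMaxCliqueSum {V : Type*} [Fintype V] (G : SimpleGraph V) {A : V → Type*}
    (f : (∀ i, A i) → ℝ) : Prop :=
  ∃ φ : Finset V → ((∀ i, A i) → ℝ),
    (∀ C : Finset V, ¬ IsMaxClique G C → φ C = 0) ∧
    (∀ C : Finset V, LocalOn C (φ C)) ∧
    ∀ x, f x = ∑ C : Finset V, φ C x

/-- The effect on `f` of changing coordinate `i` depends only on the closed neighborhood
of `i`. -/
def HasLocalDifferences {V : Type*} [DecidableEq V] (G : SimpleGraph V) {A : V → Type*}
    (f : (∀ i, A i) → ℝ) : Prop :=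
  ∀ (i : V) (x y : ∀ j, A j) (a : A i), x i = y i → (∀ j, G.Adj i j → x j = y j) →
    f (Function.update x i a) - f x = f (Function.update y i a) - f y

theorem SimpleGraph.IsClique.exists_isMaxClique {V : Type*} [Fintype V] {G : SimpleGraph V}
    {S : Finset V} (hS : G.IsClique (S : Set V)) : ∃ C, S ⊆ C ∧ IsMaxClique G C := by
  obtain ⟨C, hSC, hC⟩ :=
    Finite.exists_le_maximal (p := fun D : Finset V => G.IsClique (D : Set V)) hS
  exact ⟨C, hSC, hC.prop, fun D hD hCD => hC.eq_of_le hD hCD⟩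

section

variable {V : Type*} {G : SimpleGraph V} {A : V → Type*} {f g : (∀ i, A i) → ℝ}

theorem LocalOn.mono {S T : Finset V} (hf : LocalOn S f) (hST : S ⊆ T) : LocalOn T f :=
  fun x y h => hf x y fun j hj => h j (hST hj)

theorem LocalOn.comp_update [DecidableEq V] {S : Finset V} (hf : LocalOn S f) (k : V) (c : A k) :
    LocalOn (S.erase k) fun x => f (Function.update x k c) := by
  refine fun x y h => hf _ _ fun j hj => ?_
  obtain rfl | hjk := eq_or_ne j k
  · simp
  · simp [hjk, h j (Finset.mem_erase.2 ⟨hjk, hj⟩)]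

theorem HasLocalDifferences.comp_update [DecidableEq V] (hf : HasLocalDifferences G f)
    (k : V) (c : A k) : HasLocalDifferences G fun x => f (Function.update x k c) := by
  intro i x y a hi hadj
  obtain rfl | hik := eq_or_ne i k
  · simp
  · simp only [Function.update_comm hik]
    refine hf i _ _ a (by simp [hik, hi]) fun j hj => ?_
    obtain rfl | hjk := eq_or_ne j k
    · simp
    · simp [hjk, hadj j hj]

theorem IsMaxCliqueSum.add [Fintype V] (hf : IsMaxCliqueSum G f) (hg : IsMaxCliqueSum G g) :
    IsMaxCliqueSum G (f + g) := by
  obtain ⟨φ, hφ, hφl, hφs⟩ := hf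
  obtain ⟨ψ, hψ, hψl, hψs⟩ := hg
  refine ⟨φ + ψ, fun C hC => by simp [hφ C hC, hψ C hC], fun C x y h => ?_, fun x => ?_⟩
  · simp [hφl C x y h, hψl C x y h]
  · simp [hφs, hψs, Finset.sum_add_distrib]

theorem IsMaxCliqueSum.neg [Fintype V] (hf : IsMaxCliqueSum G f) : IsMaxCliqueSum G (-f) := by
  obtain ⟨φ, hφ, hφl, hφs⟩ := hf
  refine ⟨-φ, fun C hC => by simp [hφ C hC], fun C x y h => ?_, fun x => ?_⟩
  · simp [hφl C x y h]
  · simp [hφs]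

theorem LocalOn.isMaxCliqueSum [Fintype V] [DecidableEq V] {S : Finset V} (hf : LocalOn S f)
    (hS : G.IsClique (S : Set V)) : IsMaxCliqueSum G f := by
  obtain ⟨C, hSC, hC⟩ := hS.exists_isMaxClique
  refine ⟨fun D => if D = C then f else 0, fun D hD => ?_, fun D x y h => ?_, fun x => ?_⟩
  · exact if_neg fun h : D = C => hD (h ▸ hC)
  · by_cases hDC : D = C
    · subst hDC
      simpa using hf.mono hSC x y h
    · simp [hDC]
  · simp [ite_apply]

theorem HasLocalDifferences.isMaxCliqueSum [Fintype V] [DecidableEq V] [∀ i, Nonempty (A i)]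
    {S : Finset V} (hf : HasLocalDifferences G f) (hS : LocalOn S f) : IsMaxCliqueSum G f := by
  induction S using Finset.strongInduction generalizing f with
  | H S ih =>
    by_cases hc : G.IsClique (S : Set V)
    · exact hS.isMaxCliqueSum hc
    · simp only [SimpleGraph.isClique_iff, Set.Pairwise, not_forall] at hc
      obtain ⟨i, hi, j, hj, hij, hadj⟩ := hc
      obtain ⟨a⟩ := ‹∀ i, Nonempty (A i)› i
      obtain ⟨b⟩ := ‹∀ i, Nonempty (A i)› j
      have hSi := Finset.erase_ssubset hi
      have hfi := hf.comp_update i a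
      have hli := hS.comp_update i a
      convert (ih _ hSi hfi hli).add
        ((ih _ (Finset.erase_ssubset hj) (hf.comp_update j b) (hS.comp_update j b)).add
          (ih _ ((Finset.erase_subset j _).trans_ssubset hSi) (hfi.comp_update j b)
            (hli.comp_update j b)).neg) using 1
      funext x
      have hx := hf i x (Function.update x j b) a (by simp [hij]) fun k hk => by
        have hkj : k ≠ j := fun h => hadj (h ▸ hk)
        simp [hkj]
      simp only [Pi.add_apply, Pi.neg_apply]
      linarith

end

/-- Any `w`-weighted Gibbs-potential game with graph `G` and potential `Ψ` is `w`-scaled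
payoff-difference equivalent to a hyperedge-symmetric hypergraphical game whose hyperedges are
the maximal cliques of `G`: there are local potentials `φ C`, one per maximal clique, with
`Ψ = ∑ C, φ C` and every unilateral payoff difference of player `i` equal to `w i` times the
sum over the maximal cliques containing `i` of the corresponding local-potential differences. -/
theorem weighted_gibbs_potential_game_equiv_hyperedge_symmetric
    {V : Type*} [Fintype V] [DecidableEq V] [Nonempty V] (G : SimpleGraph V)
    {A : V → Type*} [∀ i, Fintype (A i)] [∀ i, Nonempty (A i)]
    (w : V → ℝ) (hw : ∀ i, 0 < w i)
    (M : V → (∀ i, A i) → ℝ)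
    (hMlocal : ∀ (i : V) (x y : ∀ j, A j), x i = y i →
      (∀ j, G.Adj i j → x j = y j) → M i x = M i y)
    (Ψ : (∀ i, A i) → ℝ)
    (hpot : ∀ (i : V) (x : ∀ j, A j) (a a' : A i),
      M i (Function.update x i a) - M i (Function.update x i a') =
        w i * (Ψ (Function.update x i a) - Ψ (Function.update x i a'))) :
    ∃ φ : Finset V → ((∀ i, A i) → ℝ),
      (∀ C : Finset V, ¬ IsMaxClique G C → φ C = 0) ∧
      (∀ C : Finset V, LocalOn C (φ C)) ∧
      (∀ x, Ψ x = ∑ C : Finset V, φ C x) ∧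
      (∀ (i : V) (x : ∀ j, A j) (a a' : A i),
        M i (Function.update x i a) - M i (Function.update x i a') =
          w i * ∑ C ∈ Finset.univ.filter (fun C : Finset V => i ∈ C),
            (φ C (Function.update x i a) - φ C (Function.update x i a'))) := by
  have hΨ : HasLocalDifferences G Ψ := by
    intro i x y a hi hadj
    have hx := hpot i x a (x i)
    have hy := hpot i y a (y i)
    have hM : M i (Function.update x i a) = M i (Function.update y i a) :=
      hMlocal i _ _ (by simp) fun j hj => by simp [hj.ne', hadj j hj]
    rw [Function.update_eq_self] at hx hy
    rw [hM, hMlocal i x y hi hadj, hy] at hx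
    exact (mul_left_cancel₀ (hw i).ne' hx).symm
  obtain ⟨φ, hφ, hφl, hφs⟩ :=
    hΨ.isMaxCliqueSum (S := Finset.univ)
      fun x y h => congrArg Ψ (funext fun j => h j (Finset.mem_univ j))
  refine ⟨φ, hφ, hφl, hφs, fun i x a a' => ?_⟩
  rw [hpot, hφs, hφs, ← Finset.sum_sub_distrib, Finset.sum_filter_of_ne]
  intro C _ hne
  contrapose! hne
  refine sub_eq_zero.2 (hφl C _ _ fun j hj => ?_)
  have hji : j ≠ i := fun h => hne (h ▸ hj)
  simp [hji]
end

section
/- If G has totally disconnected neighborhoods (for every vertex i and every pair of distinct neighbors j, k ∈ 𝒩(i), j and k are not adjacent in G), then any w-weighted Gibbs-potential game with graph G is w-scaled payoff-difference equivalent to a pairwise-symmetric graphical polymatrix game: there exist functions φ_{ij} : A_i × A_j → ℝ for each edge {i,j} ∈ E (with φ_{ij}(x_i,x_j) = φ_{ji}(x_j,x_i)) and functions φ_i : A_i → ℝ such that for every player i, all x_{-i}, and all x_i, x'_i ∈ A_i, M_i(x_i, x_{-i}) − M_i(x'_i, x_{-i}) = w_i · ( Σ_{j∈𝒩(i)} (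 φ_{ij}(x_i, x_j) − φ_{ij}(x'_i, x_j) ) + φ_i(x_i) − φ_i(x'_i) ). -/
open Function in
/-- Unilateral differences of the potential of a graphical game depend only on the actions of
the neighbors. -/
theorem potential_diff_eq_of_eq_on_neighbors
    {V : Type*} [DecidableEq V] (G : SimpleGraph V) {A : V → Type*}
    (w : V → ℝ) (hw : ∀ i, 0 < w i) (M : V → (∀ i, A i) → ℝ)
    (hMlocal : ∀ (i : V) (x y : ∀ j, A j), x i = y i →
      (∀ j, G.Adj i j → x j = y j) → M i x = M i y)
    (Ψ : (∀ i, A i) → ℝ)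
    (hpot : ∀ (i : V) (x : ∀ j, A j) (a a' : A i),
      M i (update x i a) - M i (update x i a') = w i * (Ψ (update x i a) - Ψ (update x i a')))
    (i : V) (x y : ∀ j, A j) (hxy : ∀ j, G.Adj i j → x j = y j) (a a' : A i) :
    Ψ (update x i a) - Ψ (update x i a') = Ψ (update y i a) - Ψ (update y i a') := by
  have hM : ∀ c : A i, M i (update x i c) = M i (update y i c) := fun c =>
    hMlocal i _ _ (by simp) fun j hj => by
      rw [update_of_ne hj.ne', update_of_ne hj.ne', hxy j hj]
  apply mul_left_cancel₀ (hw i).ne'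
  rw [← hpot, ← hpot, hM, hM]

open Function in
/-- If unilateral differences of `Ψ` depend only on the actions of the neighbors, and no two
members of `S` are adjacent neighbors of `i`, then the unilateral difference at `i` splits into
pairwise mixed differences, for profiles that agree with `o` outside `S`. -/
theorem potential_diff_piecewise_eq_sum
    {V : Type*} [DecidableEq V] (G : SimpleGraph V) {A : V → Type*}
    (hTDN : ∀ i j k : V, G.Adj i j → G.Adj i k → j ≠ k → ¬ G.Adj j k)
    (Ψ : (∀ i, A i) → ℝ)
    (hloc : ∀ (i : V) (x y : ∀ j, A j), (∀ j, G.Adj i j → x j = y j) → ∀ a a' : A i,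
      Ψ (update x i a) - Ψ (update x i a') = Ψ (update y i a) - Ψ (update y i a'))
    (o x : ∀ j, A j) (i : V) (a : A i) (S : Finset V) (hS : ∀ j ∈ S, G.Adj i j) :
    Ψ (update (S.piecewise x o) i a) - Ψ (update (S.piecewise x o) i (o i)) =
      ∑ j ∈ S, (Ψ (update (update o i a) j (x j)) - Ψ (update o j (x j))
        - Ψ (update o i a) + Ψ o) + (Ψ (update o i a) - Ψ o) := by
  induction S using Finset.induction_on with
  | empty => simp
  | insert k S hk ih =>
    have hik : G.Adj i k := hS k (Finset.mem_insert_self k S)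
    have hS' : ∀ j ∈ S, G.Adj i j := fun j hj => hS j (Finset.mem_insert_of_mem hj)
    have hdiff : ∀ c : A i,
        Ψ (update (update (S.piecewise x o) k (x k)) i c) - Ψ (update (S.piecewise x o) i c) =
          Ψ (update (update o i c) k (x k)) - Ψ (update o i c) := by
      intro c
      have h := hloc k (update (S.piecewise x o) i c) (update o i c) (fun j hj => by
        rcases eq_or_ne j i with rfl | hji
        · simp
        · have hjS : j ∉ S := fun hjS => hTDN i k j hik (hS' j hjS) hj.ne hj
          simp [hji, hjS]) (x k) (o k)
      have hz : update (update (S.piecewise x o) i c) k (o k) = update (S.piecewise x o) i c :=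
        update_eq_self_iff.2 (by simp [hik.ne', hk])
      have ho : update (update o i c) k (o k) = update o i c :=
        update_eq_self_iff.2 (by simp [hik.ne'])
      rwa [hz, ho, update_comm hik.ne] at h
    have h₁ := hdiff a
    have h₂ := hdiff (o i)
    rw [update_eq_self] at h₂
    rw [Finset.piecewise_insert, Finset.sum_insert hk]
    linarith [ih hS']


/-- If the graph `G` has totally disconnected neighborhoods (no two neighbors of any vertex are
adjacent), then any `w`-weighted Gibbs-potential game with graph `G` is `w`-scaled
payoff-difference equivalent to a pairwise-symmetric graphical polymatrix game: there are
symmetric pairwise functions `φ2 i j : A i → A j → ℝ` for adjacent `i, j` and singleton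
functions `φ1 i : A i → ℝ` such that every unilateral payoff difference of player `i` equals
`w i` times the sum of the corresponding pairwise differences over the neighbors of `i`
plus the singleton difference. -/
theorem weighted_gibbs_potential_game_totally_disconnected_is_polymatrix
    {V : Type*} [Fintype V] [DecidableEq V] (G : SimpleGraph V) [DecidableRel G.Adj]
    {A : V → Type*} [∀ i, Fintype (A i)] [∀ i, Nonempty (A i)]
    (hTDN : ∀ i j k : V, G.Adj i j → G.Adj i k → j ≠ k → ¬ G.Adj j k)
    (w : V → ℝ) (hw : ∀ i, 0 < w i)
    (M : V → (∀ i, A i) → ℝ)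
    (hMlocal : ∀ (i : V) (x y : ∀ j, A j), x i = y i →
      (∀ j, G.Adj i j → x j = y j) → M i x = M i y)
    (Ψ : (∀ i, A i) → ℝ)
    (hpot : ∀ (i : V) (x : ∀ j, A j) (a a' : A i),
      M i (Function.update x i a) - M i (Function.update x i a') =
        w i * (Ψ (Function.update x i a) - Ψ (Function.update x i a'))) :
    ∃ (φ2 : (i : V) → (j : V) → A i → A j → ℝ) (φ1 : (i : V) → A i → ℝ),
      (∀ (i j : V) (a : A i) (b : A j), G.Adj i j → φ2 i j a b = φ2 j i b a) ∧
      (∀ (i : V) (x : ∀ j, A j) (a a' : A i),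
        M i (Function.update x i a) - M i (Function.update x i a') =
          w i * ((∑ j ∈ G.neighborFinset i, (φ2 i j a (x j) - φ2 i j a' (x j))) +
            (φ1 i a - φ1 i a'))) := by
  classical
  have hloc := potential_diff_eq_of_eq_on_neighbors G w hw M hMlocal Ψ hpot
  let o : ∀ i, A i := fun i => Classical.arbitrary (A i)
  refine ⟨fun i j a b => Ψ (Function.update (Function.update o i a) j b)
    - Ψ (Function.update o j b) - Ψ (Function.update o i a) + Ψ o,
    fun i a => Ψ (Function.update o i a) - Ψ o, fun i j a b hij => ?_, fun i x a a' => ?_⟩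
  · simp only [Function.update_comm hij.ne a b]
    ring
  · have key : ∀ c : A i, Ψ (Function.update x i c) - Ψ (Function.update x i (o i)) = _ :=
      fun c => (hloc i x ((G.neighborFinset i).piecewise x o)
        (fun j hj => by simp [hj]) c (o i)).trans
        (potential_diff_piecewise_eq_sum G hTDN Ψ hloc o x i c (G.neighborFinset i)
          fun j hj => by simpa using hj)
    rw [hpot, Finset.sum_sub_distrib]
    congr 1
    linarith [key a, key a']
end

section
/- If Ψ is an exact potential of a graphical game whose graph G has totally disconnected neighborhoods (for every vertex i and every pair of distinct neighbors j, k ∈ 𝒩(i), j and k are not adjacent), then Ψ decomposes into pairwise and singleton terms: there exist functions φ_{ij} : A_i × A_j → ℝ for each edge {i,j} ∈ E and functions φ_i : A_i → ℝ for each i ∈ V such that Ψ(x) = Σ_{{i,j}∈E} φ_{ij}(x_i, x_j) + Σ_{i∈V} φ_i(x_i) for all x ∈ A. -/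
section

variable {V : Type*} [DecidableEq V] {A : V → Type*}

/-- If the payoff of player `k` only depends on the actions of its neighbors and its own action,
then the increments of an exact potential in direction `k` are local as well. -/
lemma potential_increment_congr (G : SimpleGraph V) {M : V → (∀ i, A i) → ℝ}
    (hMlocal : ∀ (i : V) (x y : ∀ j, A j), x i = y i →
      (∀ j, G.Adj i j → x j = y j) → M i x = M i y)
    {Ψ : (∀ i, A i) → ℝ}
    (hpot : ∀ (i : V) (x : ∀ j, A j) (a a' : A i),
      M i (Function.update x i a) - M i (Function.update x i a') =
        Ψ (Function.update x i a) - Ψ (Function.update x i a'))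
    (k : V) (a a' : A k) (z w : ∀ i, A i) (h : ∀ j, G.Adj k j → z j = w j) :
    Ψ (Function.update z k a) - Ψ (Function.update z k a') =
      Ψ (Function.update w k a) - Ψ (Function.update w k a') := by
  have key : ∀ c : A k, M k (Function.update z k c) = M k (Function.update w k c) := by
    intro c
    apply hMlocal
    · simp
    · intro j hj
      rw [Function.update_of_ne hj.ne', Function.update_of_ne hj.ne', h j hj]
  rw [← hpot, ← hpot, key, key]

/-- If increments of `Ψ` are local and `G` has totally disconnected neighborhoods, then the mixed
second difference of `Ψ` along an edge does not depend on the remaining coordinates. -/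
lemma mixed_difference_congr (G : SimpleGraph V)
    (hTDN : ∀ i j k : V, G.Adj i j → G.Adj i k → j ≠ k → ¬ G.Adj j k)
    {Ψ : (∀ i, A i) → ℝ}
    (hΨ : ∀ (k : V) (a a' : A k) (z w : ∀ i, A i), (∀ j, G.Adj k j → z j = w j) →
      Ψ (Function.update z k a) - Ψ (Function.update z k a') =
        Ψ (Function.update w k a) - Ψ (Function.update w k a'))
    {j k : V} (hjk : G.Adj j k) (a a' : A j) (c c' : A k) (z w : ∀ i, A i) :
    (Ψ (Function.update (Function.update z j a) k c) -
        Ψ (Function.update (Function.update z j a) k c')) -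
      (Ψ (Function.update (Function.update z j a') k c) -
        Ψ (Function.update (Function.update z j a') k c')) =
    (Ψ (Function.update (Function.update w j a) k c) -
        Ψ (Function.update (Function.update w j a) k c')) -
      (Ψ (Function.update (Function.update w j a') k c) -
        Ψ (Function.update (Function.update w j a') k c')) := by
  classical
  let u : ∀ i, A i := fun i => if G.Adj k i then z i else w i
  have hk : ∀ (d : A j) (i : V), G.Adj k i →
      Function.update z j d i = Function.update u j d i := by
    intro d i hi
    by_cases hij : i = j
    · subst hij; simp
    · simp [Function.update_of_ne hij, u, hi]
  have hj : ∀ (d : A k) (i : V), G.Adj j i →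
      Function.update u k d i = Function.update w k d i := by
    intro d i hi
    by_cases hik : i = k
    · subst hik; simp
    · have : ¬ G.Adj k i := hTDN j k i hjk hi (Ne.symm hik)
      simp [Function.update_of_ne hik, u, this]
  have h1 := hΨ k c c' _ _ (hk a)
  have h2 := hΨ k c c' _ _ (hk a')
  have h3 := hΨ j a a' _ _ (hj c)
  have h4 := hΨ j a a' _ _ (hj c')
  simp only [Function.update_comm hjk.ne'] at h3 h4
  linarith

/-- The order-two interaction term of `Ψ` at the pair `e`, relative to the base point `b`. -/
def pairInteraction (Ψ : (∀ i, A i) → ℝ) (b : ∀ i, A i) (e : Sym2 V) (x : ∀ i, A i) : ℝ :=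
  Ψ (e.toFinset.piecewise x b) - ∑ i ∈ e.toFinset, (Ψ (Function.update b i (x i)) - Ψ b) - Ψ b

lemma pairInteraction_congr (Ψ : (∀ i, A i) → ℝ) (b : ∀ i, A i) (e : Sym2 V)
    (x y : ∀ i, A i) (h : ∀ j ∈ e, x j = y j) :
    pairInteraction Ψ b e x = pairInteraction Ψ b e y := by
  have h' : ∀ j ∈ e.toFinset, x j = y j := fun j hj => h j (Sym2.mem_toFinset.mp hj)
  have hp : e.toFinset.piecewise x b = e.toFinset.piecewise y b :=
    Finset.piecewise_congr _ h' fun _ _ => rfl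
  unfold pairInteraction
  rw [hp, Finset.sum_congr rfl fun i hi => by rw [h' i hi]]

lemma pairInteraction_mk (Ψ : (∀ i, A i) → ℝ) (b : ∀ i, A i) {j k : V} (hjk : j ≠ k)
    (x : ∀ i, A i) :
    pairInteraction Ψ b s(j, k) x =
      Ψ (Function.update (Function.update b j (x j)) k (x k)) -
        Ψ (Function.update b j (x j)) - Ψ (Function.update b k (x k)) + Ψ b := by
  have hp : (s(j, k).toFinset).piecewise x b =
      Function.update (Function.update b j (x j)) k (x k) := by
    rw [Sym2.toFinset_mk_eq, Finset.pair_comm, Finset.piecewise_insert,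
      Finset.piecewise_singleton]
  unfold pairInteraction
  rw [hp, Sym2.toFinset_mk_eq, Finset.sum_pair hjk]
  ring

/-- Increment of `Ψ` in direction `k` at a point that differs from `b` only on `T`. -/
lemma increment_piecewise_eq (G : SimpleGraph V) [DecidableRel G.Adj]
    (hTDN : ∀ i j k : V, G.Adj i j → G.Adj i k → j ≠ k → ¬ G.Adj j k)
    {Ψ : (∀ i, A i) → ℝ}
    (hΨ : ∀ (k : V) (a a' : A k) (z w : ∀ i, A i), (∀ j, G.Adj k j → z j = w j) →
      Ψ (Function.update z k a) - Ψ (Function.update z k a') =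
        Ψ (Function.update w k a) - Ψ (Function.update w k a'))
    (b x : ∀ i, A i) (k : V) (T : Finset V) :
    Ψ (Function.update (T.piecewise x b) k (x k)) -
        Ψ (Function.update (T.piecewise x b) k (b k)) =
      Ψ (Function.update b k (x k)) - Ψ b +
        ∑ j ∈ T with G.Adj j k, pairInteraction Ψ b s(j, k) x := by
  induction T using Finset.induction_on with
  | empty => simp
  | insert j T hjT ih =>
    rw [Finset.piecewise_insert, Finset.filter_insert]
    have hb : Function.update (T.piecewise x b) j (b j) = T.piecewise x b := by
      rw [Function.update_eq_self_iff, Finset.piecewise_eq_of_notMem _ _ _ hjT]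
    split_ifs with hjk
    · rw [Finset.sum_insert (by simp [hjT]), pairInteraction_mk Ψ b hjk.ne]
      have h := mixed_difference_congr G hTDN hΨ hjk (x j) (b j) (x k) (b k) (T.piecewise x b) b
      have hbk : Function.update (Function.update b j (x j)) k (b k) =
          Function.update b j (x j) := by
        rw [Function.update_eq_self_iff, Function.update_of_ne hjk.ne']
      rw [hb, hbk, Function.update_eq_self, Function.update_eq_self] at h
      linarith
    · rw [← ih]
      apply hΨ
      intro i hi
      rw [Function.update_of_ne]
      rintro rfl
      exact hjk hi.symm

lemma potential_piecewise_eq [Fintype V] (G : SimpleGraph V) [DecidableRel G.Adj]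
    (hTDN : ∀ i j k : V, G.Adj i j → G.Adj i k → j ≠ k → ¬ G.Adj j k)
    {Ψ : (∀ i, A i) → ℝ}
    (hΨ : ∀ (k : V) (a a' : A k) (z w : ∀ i, A i), (∀ j, G.Adj k j → z j = w j) →
      Ψ (Function.update z k a) - Ψ (Function.update z k a') =
        Ψ (Function.update w k a) - Ψ (Function.update w k a'))
    (b x : ∀ i, A i) (S : Finset V) :
    Ψ (S.piecewise x b) =
      Ψ b + ∑ i ∈ S, (Ψ (Function.update b i (x i)) - Ψ b) +
        ∑ e ∈ G.edgeFinset with ∀ i ∈ e, i ∈ S, pairInteraction Ψ b e x := by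
  induction S using Finset.induction_on with
  | empty =>
    have : G.edgeFinset.filter (fun e => ∀ i ∈ e, i ∈ (∅ : Finset V)) = ∅ := by
      refine Finset.filter_eq_empty_iff.mpr fun e _ h => ?_
      induction e with
      | _ i j => simpa using h i (Sym2.mem_mk_left i j)
    rw [this]
    simp
  | insert k S hkS ih =>
    have hsplit : G.edgeFinset.filter (fun e => ∀ i ∈ e, i ∈ insert k S) =
        G.edgeFinset.filter (fun e => ∀ i ∈ e, i ∈ S) ∪
          (S.filter (G.Adj · k)).image (fun j => s(j, k)) := by
      ext e
      induction e with
      | _ i j =>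
        simp only [Finset.mem_filter, SimpleGraph.mem_edgeFinset, SimpleGraph.mem_edgeSet,
          Sym2.mem_iff, forall_eq_or_imp, forall_eq, Finset.mem_insert, Finset.mem_union,
          Finset.mem_image, Sym2.eq_iff]
        constructor
        · rintro ⟨hij, rfl | hi, rfl | hj⟩
          · exact (G.loopless.irrefl _ hij).elim
          · exact Or.inr ⟨j, ⟨hj, hij.symm⟩, by simp⟩
          · exact Or.inr ⟨i, ⟨hi, hij⟩, by simp⟩
          · exact Or.inl ⟨hij, hi, hj⟩
        · rintro (⟨hij, hi, hj⟩ | ⟨l, ⟨hl, hlk⟩, ⟨rfl, rfl⟩ | ⟨rfl, rfl⟩⟩)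
          · exact ⟨hij, Or.inr hi, Or.inr hj⟩
          · exact ⟨hlk, Or.inr hl, Or.inl rfl⟩
          · exact ⟨hlk.symm, Or.inl rfl, Or.inr hl⟩
    have hdisj : Disjoint (G.edgeFinset.filter (fun e => ∀ i ∈ e, i ∈ S))
        ((S.filter (G.Adj · k)).image (fun j => s(j, k))) := by
      refine Finset.disjoint_left.mpr fun e he he' => ?_
      obtain ⟨j, -, rfl⟩ := Finset.mem_image.mp he'
      exact hkS ((Finset.mem_filter.mp he).2 k (Sym2.mem_mk_right j k))
    have hb : Function.update (S.piecewise x b) k (b k) = S.piecewise x b := by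
      rw [Function.update_eq_self_iff, Finset.piecewise_eq_of_notMem _ _ _ hkS]
    have h := increment_piecewise_eq G hTDN hΨ b x k S
    rw [hb] at h
    rw [hsplit, Finset.sum_union hdisj, Finset.sum_image fun i _ j _ hij => Sym2.congr_left.mp hij,
      Finset.sum_insert hkS, Finset.piecewise_insert]
    linarith

end

/-- If `Ψ` is an exact potential of a graphical game whose graph `G` has totally disconnected
neighborhoods, then `Ψ` decomposes into pairwise terms, one for each edge of `G` (represented
by a function `ψ e` on joint actions depending only on the two endpoints of the edge `e`),
plus singleton terms `φ1 i : A i → ℝ`. -/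
theorem exact_potential_totally_disconnected_pairwise_decomposition
    {V : Type*} [Fintype V] [DecidableEq V] [Nonempty V]
    (G : SimpleGraph V) [DecidableRel G.Adj]
    {A : V → Type*} [∀ i, Fintype (A i)] [∀ i, Nonempty (A i)]
    (hTDN : ∀ i j k : V, G.Adj i j → G.Adj i k → j ≠ k → ¬ G.Adj j k)
    (M : V → (∀ i, A i) → ℝ)
    (hMlocal : ∀ (i : V) (x y : ∀ j, A j), x i = y i →
      (∀ j, G.Adj i j → x j = y j) → M i x = M i y)
    (Ψ : (∀ i, A i) → ℝ)
    (hpot : ∀ (i : V) (x : ∀ j, A j) (a a' : A i),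
      M i (Function.update x i a) - M i (Function.update x i a') =
        Ψ (Function.update x i a) - Ψ (Function.update x i a')) :
    ∃ (ψ : Sym2 V → ((∀ i, A i) → ℝ)) (φ1 : (i : V) → A i → ℝ),
      (∀ (e : Sym2 V) (x y : ∀ i, A i), (∀ j ∈ e, x j = y j) → ψ e x = ψ e y) ∧
      (∀ x, Ψ x = (∑ e ∈ G.edgeFinset, ψ e x) + ∑ i : V, φ1 i (x i)) := by
  have b : ∀ i, A i := fun i => Classical.arbitrary (A i)
  have hΨ := potential_increment_congr G hMlocal hpot
  refine ⟨pairInteraction Ψ b,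
    fun i a => Ψ (Function.update b i a) - Ψ b + Ψ b / Fintype.card V,
    pairInteraction_congr Ψ b, fun x => ?_⟩
  have h := potential_piecewise_eq G hTDN hΨ b x Finset.univ
  have hcard : (Fintype.card V : ℝ) ≠ 0 := Nat.cast_ne_zero.mpr Fintype.card_ne_zero
  have hconst : ∑ _i : V, Ψ b / Fintype.card V = Ψ b := by
    rw [Finset.sum_const, Finset.card_univ, nsmul_eq_mul, mul_div_cancel₀ _ hcard]
  rw [Finset.sum_add_distrib, hconst]
  simp only [Finset.piecewise_univ, Finset.mem_univ, implies_true, Finset.filter_true] at h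
  linarith
end

section
/- Under the hypotheses that, for every player i of a graphical game with graph G, the local smooth best-response scheme p_i(x_i | x_{𝒩(i)}) = exp(f_i(M′_i(x_i, x_{𝒩(i)}), x_{𝒩(i)})) / Σ_{x'_i} exp(f_i(M′_i(x'_i, x_{𝒩(i)}), x_{𝒩(i)})) coincides with the conditionals of a positive distribution P̂(x) = exp(Ψ̂(x)) / Σ_y exp(Ψ̂(y)), and that each f_i is a preference-order-preserving transform (v ↦ f_i(v, x_{𝒩(i)}) is strictly increasing for every x_{𝒩(i)}), the function Ψ̂ is an ordinal potential for the game: for all i, x_{-i}, x_i, x'_i, M′_i(x_i, x_{𝒩(i)}) − M′_i(x'_i, x_{𝒩(i)}) > 0 if and only if Ψ̂(x_i, x_{-i}) − Ψ̂(x'_i, x_{-i}) > 0. -/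
/-- If the local smooth best-response schemes of a graphical game, built from
preference-order-preserving transforms `f i` (strictly increasing in the real argument),
coincide with the conditionals of the positive distribution `P̂ x = exp (Ψ x) / ∑ y, exp (Ψ y)`,
then `Ψ` is an ordinal potential of the game: unilateral payoff differences and the
corresponding differences of `Ψ` always have the same sign. -/
theorem sbr_conditionals_give_ordinal_potential
    {V : Type*} [Fintype V] [DecidableEq V] (G : SimpleGraph V)
    {A : V → Type*} [∀ i, Fintype (A i)] [∀ i, Nonempty (A i)]
    (M : V → (∀ i, A i) → ℝ)
    (hMlocal : ∀ (i : V) (x y : ∀ j, A j), x i = y i →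
      (∀ j, G.Adj i j → x j = y j) → M i x = M i y)
    (f : V → ℝ → (∀ i, A i) → ℝ)
    (hflocal : ∀ (i : V) (v : ℝ) (x y : ∀ j, A j),
      (∀ j, G.Adj i j → x j = y j) → f i v x = f i v y)
    (hfmono : ∀ (i : V) (x : ∀ j, A j), StrictMono (fun v => f i v x))
    (Ψ : (∀ i, A i) → ℝ)
    (hcond : ∀ (i : V) (x : ∀ j, A j),
      (Real.exp (Ψ x) / ∑ y, Real.exp (Ψ y)) /
          (∑ a : A i, Real.exp (Ψ (Function.update x i a)) / ∑ y, Real.exp (Ψ y)) =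
        Real.exp (f i (M i x) x) /
          ∑ a : A i, Real.exp (f i (M i (Function.update x i a)) x)) :
    ∀ (i : V) (x : ∀ j, A j) (a a' : A i),
      M i (Function.update x i a) - M i (Function.update x i a') > 0 ↔
        Ψ (Function.update x i a) - Ψ (Function.update x i a') > 0 := by
  intro i x a a'
  have hZ : 0 < ∑ y, Real.exp (Ψ y) :=
    Finset.sum_pos (fun _ _ => Real.exp_pos _) Finset.univ_nonempty
  have hW : 0 < ∑ b : A i, Real.exp (Ψ (Function.update x i b)) / ∑ y, Real.exp (Ψ y) :=
    Finset.sum_pos (fun _ _ => div_pos (Real.exp_pos _) hZ) Finset.univ_nonempty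
  have hS : 0 < ∑ b : A i, Real.exp (f i (M i (Function.update x i b)) x) :=
    Finset.sum_pos (fun _ _ => Real.exp_pos _) Finset.univ_nonempty
  have hf : ∀ (b : A i) (v : ℝ), f i v (Function.update x i b) = f i v x := fun b v =>
    hflocal i v _ _ fun _ hj => Function.update_of_ne hj.ne' _ _
  have hupdate : ∀ b : A i,
      (Real.exp (Ψ (Function.update x i b)) / ∑ y, Real.exp (Ψ y)) /
          (∑ c : A i, Real.exp (Ψ (Function.update x i c)) / ∑ y, Real.exp (Ψ y)) =
        Real.exp (f i (M i (Function.update x i b)) x) /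
          ∑ c : A i, Real.exp (f i (M i (Function.update x i c)) x) := by
    intro b
    simpa only [Function.update_idem, hf] using hcond i (Function.update x i b)
  rw [gt_iff_lt, gt_iff_lt, sub_pos, sub_pos, ← (hfmono i x).lt_iff_lt, ← Real.exp_lt_exp,
    ← div_lt_div_iff_of_pos_right hS, ← hupdate, ← hupdate, div_lt_div_iff_of_pos_right hW,
    div_lt_div_iff_of_pos_right hZ, Real.exp_lt_exp]
end

section
/- Suppose every player i of a graphical game with graph G uses the smooth best-response scheme with the (unconditionally) linear transform f_i(v, x_{𝒩(i)}) = v / w_i for some w_i > 0, i.e., p_i(x_i | x_{𝒩(i)}) = exp(M′_i(x_i, x_{𝒩(i)}) / w_i) / Σ_{x'_i} exp(M′_i(x'_i, x_{𝒩(i)}) / w_i), and these schemes coincide with the conditionals of a positive distribution P̂(x) = exp(Ψ̂(x)) / Σ_y exp(Ψ̂(y)). Then the game is a w-weighted Gibbs-potential game with potential Ψ̂: for every player i, all x_{-i}, and all x_i, x'_i ∈ A_i, M′_i(x_i, x_{𝒩(i)}) − M′_i(x'_i, x_{𝒩(i)}) = w_i (Ψ̂(x_i, x_{-i}) − Ψ̂(x'_i,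 x_{-i})). -/
/-- If every player `i` of a graphical game uses the smooth best-response scheme with the
(unconditionally) linear transform `v ↦ v / w i` (with `w i > 0`), i.e.
`p_i(a | x) = exp (M i (a, x_{-i}) / w i) / ∑ a', exp (M i (a', x_{-i}) / w i)`, and these
schemes coincide with the conditionals of the positive distribution
`P̂ x = exp (Ψ x) / ∑ y, exp (Ψ y)`, then the game is a `w`-weighted Gibbs-potential game
with potential `Ψ`. -/
theorem sbr_linear_conditionals_give_weighted_potential
    {V : Type*} [Fintype V] [DecidableEq V] (G : SimpleGraph V)
    {A : V → Type*} [∀ i, Fintype (A i)] [∀ i, Nonempty (A i)]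
    (M : V → (∀ i, A i) → ℝ)
    (hMlocal : ∀ (i : V) (x y : ∀ j, A j), x i = y i →
      (∀ j, G.Adj i j → x j = y j) → M i x = M i y)
    (w : V → ℝ) (hw : ∀ i, 0 < w i)
    (Ψ : (∀ i, A i) → ℝ)
    (hcond : ∀ (i : V) (x : ∀ j, A j),
      (Real.exp (Ψ x) / ∑ y, Real.exp (Ψ y)) /
          (∑ a : A i, Real.exp (Ψ (Function.update x i a)) / ∑ y, Real.exp (Ψ y)) =
        Real.exp (M i x / w i) /
          ∑ a : A i, Real.exp (M i (Function.update x i a) / w i)) :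
    ∀ (i : V) (x : ∀ j, A j) (a a' : A i),
      M i (Function.update x i a) - M i (Function.update x i a') =
        w i * (Ψ (Function.update x i a) - Ψ (Function.update x i a')) := by
  intro i x a a'
  have hwi := (hw i).ne'
  have : Nonempty (∀ j, A j) := ⟨x⟩
  have hZ : 0 < ∑ y, Real.exp (Ψ y) :=
    Finset.sum_pos (fun _ _ => Real.exp_pos _) Finset.univ_nonempty
  have hD : 0 < ∑ b : A i, Real.exp (Ψ (Function.update x i b)) / ∑ y, Real.exp (Ψ y) :=
    Finset.sum_pos (fun _ _ => div_pos (Real.exp_pos _) hZ) Finset.univ_nonempty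
  have hS : 0 < ∑ b : A i, Real.exp (M i (Function.update x i b) / w i) :=
    Finset.sum_pos (fun _ _ => Real.exp_pos _) Finset.univ_nonempty
  have hlog (b : A i) := congrArg Real.log (hcond i (Function.update x i b))
  simp only [Function.update_idem] at hlog
  simp only [Real.log_div (div_pos (Real.exp_pos _) hZ).ne' hD.ne',
    Real.log_div (Real.exp_ne_zero _) hZ.ne', Real.log_div (Real.exp_ne_zero _) hS.ne',
    Real.log_exp] at hlog
  have hdiff : Ψ (Function.update x i a) - Ψ (Function.update x i a') =
      M i (Function.update x i a) / w i - M i (Function.update x i a') / w i := by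
    linarith [hlog a, hlog a']
  rw [hdiff]
  field_simp
end

section
/- Suppose every player i of a graphical game with graph G uses a local smooth best-response-difference scheme, i.e., a family of probability distributions p_i(· | x_{𝒩(i)}) on A_i satisfying p_i(x_i | x_{𝒩(i)}) / p_i(x'_i | x_{𝒩(i)}) = exp( f_i( M′_i(x_i, x_{𝒩(i)}) − M′_i(x'_i, x_{𝒩(i)}), x_{𝒩(i)}) ) for all x_i, x'_i, where each f_i admits a conditional inverse f_i^{-1} with f_i^{-1}(f_i(v, x_{𝒩(i)}), x_{𝒩(i)}) = v for all v. If these schemes coincide with the conditionals of a positive distribution P̂(x) = exp(Ψ̂(x)) / Σ_y exp(Ψ̂(y)), then the game is an f^{-1}-transformed potential game with potential Ψ̂: for every player i, all x_{-i}, and all x_i, x'_i ∈ A_i, M′_i(x_i, x_{𝒩(i)}) − M′_i(x'_i, x_{𝒩(i)}) = f_i^{-1}( Ψ̂(x_i, x_{-i}) − Ψ̂(x'_i, x_{-i}), x_{𝒩(i)}). -/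
/-- If every player `i` of a graphical game uses a local smooth best-response-difference
scheme `p i` (a probability distribution over `A i` for each profile of neighbors' actions)
whose ratios are `p i a x / p i a' x = exp (f i (M i (a, x_{-i}) - M i (a', x_{-i})) x)`, where
each `f i` admits a conditional inverse `finv i`, and these schemes coincide with the
conditionals of the positive distribution `P̂ x = exp (Ψ x) / ∑ y, exp (Ψ y)`, then the game
is an `f⁻¹`-transformed potential game with potential `Ψ`. -/
theorem sbrd_conditionals_give_inverse_transformed_potential
    {V : Type*} [Fintype V] [DecidableEq V] (G : SimpleGraph V)
    {A : V → Type*} [∀ i, Fintype (A i)] [∀ i, Nonempty (A i)]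
    (M : V → (∀ i, A i) → ℝ)
    (hMlocal : ∀ (i : V) (x y : ∀ j, A j), x i = y i →
      (∀ j, G.Adj i j → x j = y j) → M i x = M i y)
    (f : V → ℝ → (∀ i, A i) → ℝ)
    (hflocal : ∀ (i : V) (v : ℝ) (x y : ∀ j, A j),
      (∀ j, G.Adj i j → x j = y j) → f i v x = f i v y)
    (finv : V → ℝ → (∀ i, A i) → ℝ)
    (hinv : ∀ (i : V) (v : ℝ) (x : ∀ j, A j), finv i (f i v x) x = v)
    (p : (i : V) → A i → (∀ j, A j) → ℝ)
    (hplocal : ∀ (i : V) (a : A i) (x y : ∀ j, A j),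
      (∀ j, G.Adj i j → x j = y j) → p i a x = p i a y)
    (hpnonneg : ∀ (i : V) (a : A i) (x : ∀ j, A j), 0 ≤ p i a x)
    (hpsum : ∀ (i : V) (x : ∀ j, A j), ∑ a : A i, p i a x = 1)
    (hratio : ∀ (i : V) (x : ∀ j, A j) (a a' : A i),
      p i a x / p i a' x =
        Real.exp (f i (M i (Function.update x i a) - M i (Function.update x i a')) x))
    (Ψ : (∀ i, A i) → ℝ)
    (hcond : ∀ (i : V) (x : ∀ j, A j),
      (Real.exp (Ψ x) / ∑ y, Real.exp (Ψ y)) /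
          (∑ a : A i, Real.exp (Ψ (Function.update x i a)) / ∑ y, Real.exp (Ψ y)) =
        p i (x i) x) :
    ∀ (i : V) (x : ∀ j, A j) (a a' : A i),
      M i (Function.update x i a) - M i (Function.update x i a') =
        finv i (Ψ (Function.update x i a) - Ψ (Function.update x i a')) x := by
  intro i x a a'
  set Z := ∑ y, Real.exp (Ψ y)
  set S := ∑ b : A i, Real.exp (Ψ (Function.update x i b)) / Z
  have hZpos : 0 < Z := Finset.sum_pos (fun y _ => Real.exp_pos _) Finset.univ_nonempty
  have hSpos : 0 < S :=
    Finset.sum_pos (fun b _ => div_pos (Real.exp_pos _) hZpos) Finset.univ_nonempty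
  have hp : ∀ b : A i, p i b x = Real.exp (Ψ (Function.update x i b)) / Z / S := by
    intro b
    have hlocal : p i b x = p i b (Function.update x i b) :=
      hplocal i b _ _ fun j hj => (Function.update_of_ne hj.ne' b x).symm
    have h := hcond i (Function.update x i b)
    simp only [Function.update_idem, Function.update_self] at h
    rw [hlocal, ← h]
  have hexp := hratio i x a a'
  rw [hp, hp, div_div_div_cancel_right₀ hSpos.ne', div_div_div_cancel_right₀ hZpos.ne',
    ← Real.exp_sub] at hexp
  rw [Real.exp_injective hexp, hinv]
end

section
/- Let a graphical game with graph G be a w-weighted Gibbs-potential game with potential Ψ, i.e., M′_i(x_i, x_{𝒩(i)}) − M′_i(x'_i, x_{𝒩(i)}) = w_i (Ψ(x_i, x_{-i}) − Ψ(x'_i, x_{-i})) for all i, x_{-i}, x_i, x'_i, with w_i > 0. Define the positive distribution P(x) = exp(Ψ(x)) / Σ_y exp(Ψ(y)) and, for each player i, the smooth best-response scheme p_i(x_i | x_{𝒩(i)}) = exp(M′_i(x_i, x_{𝒩(i)}) / w_i) / Σ_{x'_i∈A_i} exp(M′_i(x'_i, x_{𝒩(i)}) / w_i). Then for every player i and every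 x ∈ A, P(X_i = x_i | X_{-i} = x_{-i}) = p_i(x_i | x_{𝒩(i)}); in particular each player's scheme is local with respect to G and the schemes are the conditionals of the joint distribution P. -/
/-- Let a graphical game with graph `G` be a `w`-weighted Gibbs-potential game with potential
`Ψ`.  Define `P x = exp (Ψ x) / ∑ y, exp (Ψ y)` and the smooth best-response schemes
`p_i(a | x) = exp (M i (a, x_{-i}) / w i) / ∑ a', exp (M i (a', x_{-i}) / w i)`.  Then the
conditionals of `P` are exactly these schemes, and in particular each player's scheme is local
with respect to `G` (it depends on the others' actions only through `i`'s neighbors). -/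
theorem weighted_potential_conditionals_are_sbr_schemes
    {V : Type*} [Fintype V] [DecidableEq V] (G : SimpleGraph V)
    {A : V → Type*} [∀ i, Fintype (A i)] [∀ i, Nonempty (A i)]
    (M : V → (∀ i, A i) → ℝ)
    (hMlocal : ∀ (i : V) (x y : ∀ j, A j), x i = y i →
      (∀ j, G.Adj i j → x j = y j) → M i x = M i y)
    (w : V → ℝ) (hw : ∀ i, 0 < w i)
    (Ψ : (∀ i, A i) → ℝ)
    (hpot : ∀ (i : V) (x : ∀ j, A j) (a a' : A i),
      M i (Function.update x i a) - M i (Function.update x i a') =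
        w i * (Ψ (Function.update x i a) - Ψ (Function.update x i a'))) :
    (∀ (i : V) (x : ∀ j, A j),
      (Real.exp (Ψ x) / ∑ y, Real.exp (Ψ y)) /
          (∑ a : A i, Real.exp (Ψ (Function.update x i a)) / ∑ y, Real.exp (Ψ y)) =
        Real.exp (M i x / w i) /
          ∑ a : A i, Real.exp (M i (Function.update x i a) / w i)) ∧
    (∀ (i : V) (x y : ∀ j, A j), x i = y i →
      (∀ j, G.Adj i j → x j = y j) →
      Real.exp (M i x / w i) / (∑ a : A i, Real.exp (M i (Function.update x i a) / w i)) =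
        Real.exp (M i y / w i) /
          (∑ a : A i, Real.exp (M i (Function.update y i a) / w i))) := by
  refine ⟨fun i x => ?_, fun i x y hi hN => ?_⟩
  · have hM : ∀ a : A i, Real.exp (M i (Function.update x i a) / w i) =
        Real.exp (Ψ (Function.update x i a)) * Real.exp (M i x / w i - Ψ x) := fun a => by
      have h := hpot i x a (x i)
      rw [Function.update_eq_self] at h
      have hwi := (hw i).ne'
      rw [← Real.exp_add]
      congr 1
      field_simp
      linarith
    have hx : Real.exp (M i x / w i) = Real.exp (Ψ x) * Real.exp (M i x / w i - Ψ x) := by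
      simpa using hM (x i)
    have hZ : ∑ y, Real.exp (Ψ y) ≠ 0 :=
      (Finset.sum_pos (fun y _ => Real.exp_pos _) Finset.univ_nonempty).ne'
    rw [← Finset.sum_div, div_div_div_cancel_right₀ hZ, Finset.sum_congr rfl fun a _ => hM a,
      ← Finset.sum_mul, hx, mul_div_mul_right _ _ (Real.exp_ne_zero _)]
  · have hupdate : ∀ a : A i, M i (Function.update x i a) = M i (Function.update y i a) :=
      fun a => hMlocal i _ _ (by simp) fun j hj => by
        simp [Function.update_of_ne hj.ne', hN j hj]
    simp only [hMlocal i x y hi hN, hupdate]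
end
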